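/- Let p ≥ 1, let λ = (λ₁,…,λ_p) be nonincreasing nonnegative weights, let γ ≥ 0, and let u ∈ ℝ^p satisfy u₁ ≥ u₂ ≥ … ≥ u_p ≥ 0. Then the components of η(u; γ, λ) satisfy η₁(u; γ) ≥ η₂(u; γ) ≥ … ≥ η_p(u; γ) ≥ 0, and moreover η_i(u; γ) ≤ u_i for every 1 ≤ i ≤ p. -/

import Mathlib

open MeasureTheory ProbabilityTheory Filter

/-- Standard Gaussian measure `N(0, I_n)` on `ℝⁿ`. -/
noncomputable def stdGaussian (n : ℕ) : Measure (Fin n → ℝ) :=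
  Measure.pi fun _ => gaussianReal 0 1

/-- The nonincreasing rearrangement of the absolute values of the entries of `x`. -/
noncomputable def sortedAbs {n : ℕ} (x : Fin n → ℝ) : Fin n → ℝ :=
  fun i => |x ((Tuple.sort fun j => -|x j|) i)|

/-- The sorted-ℓ1 (SLOPE) norm `‖x‖_λ = ∑ λ_i |x|_(i)`. -/
noncomputable def slopeNorm {n : ℕ} (lam x : Fin n → ℝ) : ℝ :=
  ∑ i, lam i * sortedAbs x i

/-- The SLOPE proximal objective `½‖u − v‖₂² + γ‖v‖_λ`. -/
noncomputable def slopeObj {n : ℕ} (lam : Fin n → ℝ) (γ : ℝ) (u v : Fin n → ℝ) : ℝ :=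
  (1/2) * ∑ i, (u i - v i)^2 + γ * slopeNorm lam v

/-- `v` is a minimizer of the SLOPE proximal objective, i.e. `v = η(u; γ, λ)`
(the minimizer is unique since the objective is strictly convex). -/
def IsSlopeProx {n : ℕ} (lam : Fin n → ℝ) (γ : ℝ) (u v : Fin n → ℝ) : Prop :=
  ∀ w, slopeObj lam γ u v ≤ slopeObj lam γ u w

/-- Rearrangement inequality: `slopeNorm` dominates every pairing of the weights with `|x|`. -/
theorem sum_mul_abs_comp_perm_le_slopeNorm {n : ℕ} {lam : Fin n → ℝ} (hlam : Antitone lam)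
    (x : Fin n → ℝ) (σ : Equiv.Perm (Fin n)) :
    ∑ i, lam i * |x (σ i)| ≤ slopeNorm lam x := by
  have hsort : Antitone (sortedAbs x) := fun i j hij =>
    neg_le_neg_iff.mp (Tuple.monotone_sort (fun j => -|x j|) hij)
  have h := (hlam.monovary hsort).sum_mul_comp_perm_le_sum_mul
    (σ := σ.trans (Tuple.sort fun j => -|x j|).symm)
  simpa [sortedAbs, slopeNorm] using h

theorem slopeNorm_le_of_abs_le {n : ℕ} {lam : Fin n → ℝ} (hlam : Antitone lam)
    (hnonneg : ∀ i, 0 ≤ lam i) {x y : Fin n → ℝ} (h : ∀ i, |x i| ≤ |y i|) :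
    slopeNorm lam x ≤ slopeNorm lam y :=
  (Finset.sum_le_sum fun i _ => mul_le_mul_of_nonneg_left (h _) (hnonneg i)).trans
    (sum_mul_abs_comp_perm_le_slopeNorm hlam y _)

/-- Averaging a vector with a permutation of itself does not increase the SLOPE norm. -/
theorem slopeNorm_average_comp_perm_le {n : ℕ} {lam : Fin n → ℝ} (hlam : Antitone lam)
    (hnonneg : ∀ i, 0 ≤ lam i) (x : Fin n → ℝ) (τ : Equiv.Perm (Fin n)) :
    slopeNorm lam (fun k => (x k + x (τ k)) / 2) ≤ slopeNorm lam x := by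
  set σ := Tuple.sort fun j => -|(x j + x (τ j)) / 2| with hσ
  have h₁ := sum_mul_abs_comp_perm_le_slopeNorm hlam x σ
  have h₂ := sum_mul_abs_comp_perm_le_slopeNorm hlam x (σ.trans τ)
  have h : slopeNorm lam (fun k => (x k + x (τ k)) / 2) ≤
      ∑ i, (lam i * |x (σ i)| + lam i * |x ((σ.trans τ) i)|) / 2 := by
    refine Finset.sum_le_sum fun i _ => ?_
    have habs : |(x (σ i) + x (τ (σ i))) / 2| ≤ (|x (σ i)| + |x (τ (σ i))|) / 2 := by
      rw [abs_div, abs_two]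
      gcongr
      exact abs_add_le _ _
    calc lam i * |(x (σ i) + x (τ (σ i))) / 2|
        ≤ lam i * ((|x (σ i)| + |x (τ (σ i))|) / 2) :=
          mul_le_mul_of_nonneg_left habs (hnonneg i)
      _ = (lam i * |x (σ i)| + lam i * |x ((σ.trans τ) i)|) / 2 := by
          rw [Equiv.trans_apply]
          ring
  rw [← Finset.sum_div, Finset.sum_add_distrib] at h
  linarith

theorem IsSlopeProx.sum_sq_le {n : ℕ} {lam u v w : Fin n → ℝ} {γ : ℝ} (hγ : 0 ≤ γ)
    (hv : IsSlopeProx lam γ u v) (hw : slopeNorm lam w ≤ slopeNorm lam v) :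
    ∑ i, (u i - v i) ^ 2 ≤ ∑ i, (u i - w i) ^ 2 := by
  have h := hv w
  have hmul := mul_le_mul_of_nonneg_left hw hγ
  unfold slopeObj at h
  linarith

/-- No coordinate of the proximal point can be improved by shrinking it. -/
theorem IsSlopeProx.sq_le_of_abs_le {n : ℕ} {lam u v : Fin n → ℝ} {γ : ℝ} (hlam : Antitone lam)
    (hnonneg : ∀ i, 0 ≤ lam i) (hγ : 0 ≤ γ) (hv : IsSlopeProx lam γ u v) {i : Fin n} {a : ℝ}
    (ha : |a| ≤ |v i|) : (u i - v i) ^ 2 ≤ (u i - a) ^ 2 := by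
  have hw : slopeNorm lam (Function.update v i a) ≤ slopeNorm lam v := by
    refine slopeNorm_le_of_abs_le hlam hnonneg fun k => ?_
    rcases eq_or_ne k i with rfl | hk
    · simpa using ha
    · simp [hk]
  by_contra! hlt
  refine (hv.sum_sq_le hγ hw).not_gt (Finset.sum_lt_sum (fun k _ => ?_) ⟨i, Finset.mem_univ i, ?_⟩)
  · rcases eq_or_ne k i with rfl | hk
    · simpa using hlt.le
    · simp [hk]
  · simpa using hlt

/-- if `u₁ ≥ … ≥ u_p ≥ 0`, then the components of `η(u; γ, λ)` are
nonincreasing, nonnegative, and dominated by the corresponding components of `u`. -/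
theorem slope_prox_ordered_nonneg_dominated
    (p : ℕ) (hp : 1 ≤ p)
    (lam : Fin p → ℝ)
    (hmono : ∀ i j : Fin p, i ≤ j → lam j ≤ lam i)
    (hnonneg : ∀ i, 0 ≤ lam i)
    (γ : ℝ) (hγ : 0 ≤ γ)
    (u : Fin p → ℝ)
    (hu_mono : ∀ i j : Fin p, i ≤ j → u j ≤ u i)
    (hu_nonneg : ∀ i, 0 ≤ u i)
    (v : Fin p → ℝ) (hv : IsSlopeProx lam γ u v) :
    (∀ i j : Fin p, i ≤ j → v j ≤ v i) ∧ (∀ i, 0 ≤ v i) ∧ (∀ i, v i ≤ u i) := by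
  have hlam : Antitone lam := hmono
  refine ⟨fun i j hij => ?_, fun i => ?_, fun i => ?_⟩
  · by_contra! hlt
    have hne : i ≠ j := by
      rintro rfl
      exact lt_irrefl _ hlt
    have h := hv.sum_sq_le hγ
      (slopeNorm_average_comp_perm_le hlam hnonneg v (Equiv.swap i j))
    rw [← sub_nonneg, ← Finset.sum_sub_distrib, Fintype.sum_eq_add i j hne] at h
    · simp only [Equiv.swap_apply_left, Equiv.swap_apply_right] at h
      nlinarith [mul_nonneg (sub_nonneg.mpr (hu_mono i j hij)) (sub_pos.mpr hlt).le,
        mul_pos (sub_pos.mpr hlt) (sub_pos.mpr hlt)]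
    · rintro k ⟨hki, hkj⟩
      simp [Equiv.swap_apply_of_ne_of_ne hki hkj]
  · by_contra! hlt
    have h := hv.sq_le_of_abs_le hlam hnonneg hγ (i := i) (a := 0) (by simp)
    nlinarith [hu_nonneg i]
  · by_contra! hlt
    have h := hv.sq_le_of_abs_le hlam hnonneg hγ (i := i) (a := u i)
      (abs_le_abs_of_nonneg (hu_nonneg i) hlt.le)
    nlinarith
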